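/- arXiv:2306.14661 — 2 statements merged into one kernel-verified Lean document; each statement's English description precedes it below -/
import Mathlib

section
/- The function Γ_s is continuous on its domain dom(Γ_s) = {X ∈ S^k : X ⪰ 0, rank(X) ≥ s} (with the subspace topology from S^k). (Lemma 2) -/
open Matrix
open scoped Matrix BigOperators Classical

noncomputable section

/-- `(1/(s−ι)) Σ_{ℓ=ι+1}^k λ_ℓ` (eigenvalues indexed from `1`). -/
def avgTail (k s : ℕ) (lam : ℕ → ℝ) (ι : ℕ) : ℝ :=
  (∑ ℓ ∈ Finset.Icc (ι + 1) k, lam ℓ) / ((s : ℝ) - ι)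

/-- The defining property of the unique index `ι` of Lemma 1
(with the convention `λ_0 = +∞`, so for `ι = 0` the left inequality is vacuous). -/
def IsIota (k s : ℕ) (lam : ℕ → ℝ) (ι : ℕ) : Prop :=
  ι < s ∧ (1 ≤ ι → avgTail k s lam ι < lam ι) ∧ lam (ι + 1) ≤ avgTail k s lam ι

/-- The unique index `ι` of Lemma 1 (junk value `0` if no such index exists). -/
def iotaOf (k s : ℕ) (lam : ℕ → ℝ) : ℕ :=
  if h : ∃ ι, IsIota k s lam ι then h.choose else 0

/-- `φ_s(λ) = Σ_{ℓ=1}^ι log λ_ℓ + (s−ι) log((1/(s−ι)) Σ_{ℓ=ι+1}^k λ_ℓ)`. -/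
def phiS (k s : ℕ) (lam : ℕ → ℝ) : ℝ :=
  (∑ ℓ ∈ Finset.Icc 1 (iotaOf k s lam), Real.log (lam ℓ)) +
    ((s : ℝ) - iotaOf k s lam) * Real.log (avgTail k s lam (iotaOf k s lam))

/-- The decreasingly ordered eigenvalues of a symmetric matrix, indexed from `1`
(junk value `0` outside `[1,k]` or if `X` is not Hermitian). -/
def eigsDesc (k : ℕ) (X : Matrix (Fin k) (Fin k) ℝ) : ℕ → ℝ := fun i =>
  if h : X.IsHermitian then
    ((((List.ofFn h.eigenvalues : List ℝ) : Multiset ℝ).sort (· ≤ ·)).reverse).getD (i - 1) 0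
  else 0

/-- `Γ_s(X) = φ_s(λ(X))` with `λ(X)` the decreasingly ordered eigenvalues of `X`. -/
def gammaS (k s : ℕ) (X : Matrix (Fin k) (Fin k) ℝ) : ℝ :=
  phiS k s (eigsDesc k X)

/-- `F_DDFact(x;Υ) = Fᵀ Diag(Υ∘x) F = Σ_i γ_i x_i F_{i·}ᵀ F_{i·}`. -/
def FDD (n k : ℕ) (F : Matrix (Fin n) (Fin k) ℝ) (x Υ : Fin n → ℝ) :
    Matrix (Fin k) (Fin k) ℝ :=
  Fᵀ * Matrix.diagonal (fun i => Υ i * x i) * F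

/-- `f_DDFact(x;Υ) = Γ_s(F_DDFact(x;Υ)) − Σ_i x_i log γ_i`. -/
def fDD (n k s : ℕ) (F : Matrix (Fin n) (Fin k) ℝ) (x Υ : Fin n → ℝ) : ℝ :=
  gammaS k s (FDD n k F x Υ) - ∑ i, x i * Real.log (Υ i)

/-- `β` of Definition 1: `β_i = 1/λ_i` for `i ≤ ι` and
`β_i = (s−ι)/Σ_{ℓ=ι+1}^k λ_ℓ` for `i > ι` (here `β` is indexed by `Fin k`, `j ↔ j+1`). -/
def betaOf (k s : ℕ) (lam : ℕ → ℝ) : Fin k → ℝ := fun j =>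
  if (j : ℕ) + 1 ≤ iotaOf k s lam then (lam ((j : ℕ) + 1))⁻¹
  else ((s : ℝ) - iotaOf k s lam) / ∑ ℓ ∈ Finset.Icc (iotaOf k s lam + 1) k, lam ℓ

/-- `F Q Diag(β) Qᵀ Fᵀ`, whose diagonal appears in the (generalized) gradients. -/
def gMat (n k s : ℕ) (F : Matrix (Fin n) (Fin k) ℝ) (Q : Matrix (Fin k) (Fin k) ℝ)
    (lam : ℕ → ℝ) : Matrix (Fin n) (Fin n) ℝ :=
  F * Q * Matrix.diagonal (betaOf k s lam) * Qᵀ * Fᵀ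

/-- `Q, λ` form a spectral decomposition of `F_DDFact(x;Υ)` as in Definition 1:
`Q` orthonormal and `F_DDFact(x;Υ) = Q Diag(λ) Qᵀ` with `λ` decreasing and nonnegative
(indexed from `1`). -/
def IsSpectralDecomp (n k : ℕ) (F : Matrix (Fin n) (Fin k) ℝ) (x Υ : Fin n → ℝ)
    (Q : Matrix (Fin k) (Fin k) ℝ) (lam : ℕ → ℝ) : Prop :=
  Q * Qᵀ = 1 ∧
  FDD n k F x Υ = Q * Matrix.diagonal (fun j : Fin k => lam ((j : ℕ) + 1)) * Qᵀ ∧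
  (∀ i, 0 ≤ lam i) ∧
  (∀ i j, 1 ≤ i → i ≤ j → j ≤ k → lam j ≤ lam i)

/-- Euclidean (2-)norm of a vector in `ℝⁿ`. -/
def enorm2 (n : ℕ) (v : Fin n → ℝ) : ℝ :=
  Real.sqrt (∑ i, (v i) ^ 2)

open Filter Topology

/-- A spectrum indexed from `1` that is nonnegative and decreasing on `[1, k]`. -/
def IsSpectrum (k : ℕ) (lam : ℕ → ℝ) : Prop :=
  (∀ i, 1 ≤ i → i ≤ k → 0 ≤ lam i) ∧
  (∀ i j, 1 ≤ i → i ≤ j → j ≤ k → lam j ≤ lam i)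

/-- The closed variant of `IsIota`, where the left inequality is not strict. -/
def IsWeakIota (k s : ℕ) (lam : ℕ → ℝ) (ι : ℕ) : Prop :=
  ι < s ∧ (1 ≤ ι → avgTail k s lam ι ≤ lam ι) ∧ lam (ι + 1) ≤ avgTail k s lam ι

/-- The expression defining `phiS`, with a prescribed index `ι`. -/
def phiAt (k s : ℕ) (lam : ℕ → ℝ) (ι : ℕ) : ℝ :=
  (∑ ℓ ∈ Finset.Icc 1 ι, Real.log (lam ℓ)) + ((s : ℝ) - ι) * Real.log (avgTail k s lam ι)

lemma IsIota.isWeakIota {k s : ℕ} {lam : ℕ → ℝ} {ι : ℕ} (h : IsIota k s lam ι) :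
    IsWeakIota k s lam ι :=
  ⟨h.1, fun h1 => (h.2.1 h1).le, h.2.2⟩

lemma mul_avgTail {k s : ℕ} (lam : ℕ → ℝ) {ι : ℕ} (h : ι < s) :
    ((s : ℝ) - ι) * avgTail k s lam ι = ∑ ℓ ∈ Finset.Icc (ι + 1) k, lam ℓ := by
  have : (s : ℝ) - ι ≠ 0 := by
    have : (ι : ℝ) < s := by exact_mod_cast h
    linarith
  rw [avgTail, mul_div_cancel₀ _ this]

lemma mul_avgTail_succ {k s : ℕ} (hsk : s ≤ k) (lam : ℕ → ℝ) {ι : ℕ} (h : ι + 1 < s) :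
    ((s : ℝ) - ι) * avgTail k s lam ι =
      lam (ι + 1) + ((s : ℝ) - (ι + 1 : ℕ)) * avgTail k s lam (ι + 1) := by
  rw [mul_avgTail lam h, mul_avgTail lam (by omega : ι < s),
    ← Finset.add_sum_Ioc_eq_sum_Icc (by omega : ι + 1 ≤ k),
    Finset.Icc_add_one_left_eq_Ioc (ι + 1)]

lemma exists_isIota {k s : ℕ} (hs0 : 0 < s) (hsk : s ≤ k) {lam : ℕ → ℝ}
    (hlam : IsSpectrum k lam) : ∃ ι, IsIota k s lam ι := by
  let P : ℕ → Prop := fun ι => ι < s ∧ (1 ≤ ι → avgTail k s lam ι < lam ι)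
  have hP0 : P 0 := ⟨hs0, fun h => by omega⟩
  obtain ⟨hlt, hleft⟩ : P (Nat.findGreatest P s) := Nat.findGreatest_spec (Nat.zero_le s) hP0
  have hmax : ∀ j, Nat.findGreatest P s < j → j ≤ s → ¬ P j :=
    fun j => Nat.findGreatest_is_greatest
  generalize Nat.findGreatest P s = ι at *
  refine ⟨ι, hlt, hleft, ?_⟩
  have hsub : (0 : ℝ) < (s : ℝ) - ι := by
    have : (ι : ℝ) < s := by exact_mod_cast hlt
    linarith
  rcases Nat.lt_or_ge (ι + 1) s with h | h
  · have hn := hmax (ι + 1) (by omega) h.le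
    have hle : lam (ι + 1) ≤ avgTail k s lam (ι + 1) := by
      by_contra! hc
      exact hn ⟨h, fun _ => hc⟩
    have heq := mul_avgTail_succ hsk lam h
    have hsub' : (0 : ℝ) < (s : ℝ) - (ι + 1 : ℕ) := by
      have : ((ι + 1 : ℕ) : ℝ) < s := by exact_mod_cast h
      linarith
    refine le_of_mul_le_mul_left ?_ hsub
    rw [heq]
    have := mul_le_mul_of_nonneg_left hle hsub'.le
    push_cast at this ⊢
    linarith
  · refine le_of_mul_le_mul_left ?_ hsub
    have hs : (s : ℝ) - ι = 1 := by
      have : s = ι + 1 := by omega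
      rw [this]
      push_cast
      ring
    rw [mul_avgTail lam hlt, hs, one_mul]
    refine Finset.single_le_sum (f := lam) (fun i hi => ?_)
      (Finset.mem_Icc.2 ⟨le_rfl, by omega⟩)
    rw [Finset.mem_Icc] at hi
    exact hlam.1 i (by omega) hi.2

lemma phiAt_eq_of_lt {k s : ℕ} (hsk : s ≤ k) {lam : ℕ → ℝ} (hlam : IsSpectrum k lam)
    {ι ι' : ℕ} (hι : IsWeakIota k s lam ι) (hι' : IsWeakIota k s lam ι') (hlt : ι < ι') :
    phiAt k s lam ι = phiAt k s lam ι' := by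
  obtain ⟨h1, -, h3⟩ := hι
  obtain ⟨h1', h2', -⟩ := hι'
  have hle : ∀ j ∈ Finset.Ioc ι ι', lam j ≤ avgTail k s lam ι := fun j hj => by
    rw [Finset.mem_Ioc] at hj
    exact (hlam.2 (ι + 1) j (by omega) (by omega) (by omega)).trans h3
  have ha : avgTail k s lam ι' ≤ avgTail k s lam ι :=
    (h2' (by omega)).trans (hle ι' (Finset.mem_Ioc.2 ⟨hlt, le_rfl⟩))
  have hsub : (0 : ℝ) < (s : ℝ) - ι' := by
    have : (ι' : ℝ) < s := by exact_mod_cast h1'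
    linarith
  have hsplit : ((s : ℝ) - ι) * avgTail k s lam ι =
      ∑ j ∈ Finset.Ioc ι ι', lam j + ((s : ℝ) - ι') * avgTail k s lam ι' := by
    rw [mul_avgTail lam h1, mul_avgTail lam h1', Finset.Icc_add_one_left_eq_Ioc,
      Finset.Icc_add_one_left_eq_Ioc]
    exact (Finset.sum_Ioc_consecutive lam hlt.le (by omega : ι' ≤ k)).symm
  have hcard : ∑ _j ∈ Finset.Ioc ι ι', avgTail k s lam ι = ((ι' : ℝ) - ι) * avgTail k s lam ι := by
    rw [Finset.sum_const, Nat.card_Ioc, nsmul_eq_mul, Nat.cast_sub hlt.le]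
  have hsum := Finset.sum_le_sum hle
  have hmul := mul_le_mul_of_nonneg_left ha hsub.le
  have hsumeq : ∑ j ∈ Finset.Ioc ι ι', lam j = ∑ _j ∈ Finset.Ioc ι ι', avgTail k s lam ι := by
    linarith
  have haeq : avgTail k s lam ι' = avgTail k s lam ι :=
    mul_left_cancel₀ hsub.ne' (by linarith)
  have hall := (Finset.sum_eq_sum_iff_of_le hle).1 hsumeq
  have hlog : ∑ j ∈ Finset.Icc 1 ι', Real.log (lam j) =
      ∑ j ∈ Finset.Icc 1 ι, Real.log (lam j) +
        ((ι' : ℝ) - ι) * Real.log (avgTail k s lam ι) := by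
    have hc : ∑ j ∈ Finset.Ioc ι ι', Real.log (lam j) =
        ((ι' : ℝ) - ι) * Real.log (avgTail k s lam ι) := by
      rw [Finset.sum_congr rfl fun j hj => by rw [hall j hj], Finset.sum_const, Nat.card_Ioc,
        nsmul_eq_mul, Nat.cast_sub hlt.le]
    rw [← hc]
    exact (Finset.sum_Ioc_consecutive (fun j => Real.log (lam j)) (Nat.zero_le ι) hlt.le).symm
  rw [phiAt, phiAt, hlog, haeq]
  ring

lemma phiAt_eq {k s : ℕ} (hsk : s ≤ k) {lam : ℕ → ℝ} (hlam : IsSpectrum k lam)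
    {ι ι' : ℕ} (hι : IsWeakIota k s lam ι) (hι' : IsWeakIota k s lam ι') :
    phiAt k s lam ι = phiAt k s lam ι' := by
  rcases lt_trichotomy ι ι' with h | h | h
  · exact phiAt_eq_of_lt hsk hlam hι hι' h
  · rw [h]
  · exact (phiAt_eq_of_lt hsk hlam hι' hι h).symm

lemma phiS_eq_phiAt {k s : ℕ} (hs0 : 0 < s) (hsk : s ≤ k) {lam : ℕ → ℝ}
    (hlam : IsSpectrum k lam) {ι : ℕ} (hι : IsWeakIota k s lam ι) :
    phiS k s lam = phiAt k s lam ι := by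
  have hex := exists_isIota hs0 hsk hlam
  have hspec : IsIota k s lam (iotaOf k s lam) := by
    rw [iotaOf, dif_pos hex]
    exact hex.choose_spec
  exact phiAt_eq hsk hlam hspec.isWeakIota hι

lemma tendsto_avgTail {α : Type*} {k s : ℕ} {l : Filter α} {lam : α → ℕ → ℝ} {lam₀ : ℕ → ℝ}
    (hlim : ∀ i, 1 ≤ i → i ≤ k → Tendsto (fun a => lam a i) l (𝓝 (lam₀ i))) (ι : ℕ) :
    Tendsto (fun a => avgTail k s (lam a) ι) l (𝓝 (avgTail k s lam₀ ι)) := by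
  refine Tendsto.div_const (tendsto_finsetSum _ fun i hi => ?_) _
  rw [Finset.mem_Icc] at hi
  exact hlim i (by omega) hi.2

lemma tendsto_phiS {α : Type*} {k s : ℕ} (hs0 : 0 < s) (hsk : s ≤ k) (l : Ultrafilter α)
    {lam : α → ℕ → ℝ} {lam₀ : ℕ → ℝ} (hlam : ∀ᶠ a in (l : Filter α), IsSpectrum k (lam a))
    (hlam₀ : IsSpectrum k lam₀) (hpos : 0 < lam₀ s)
    (hlim : ∀ i, 1 ≤ i → i ≤ k → Tendsto (fun a => lam a i) l (𝓝 (lam₀ i))) :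
    Tendsto (fun a => phiS k s (lam a)) l (𝓝 (phiS k s lam₀)) := by
  have hex : ∀ᶠ a in (l : Filter α), ∃ ι ∈ Set.Iio s, IsWeakIota k s (lam a) ι := by
    filter_upwards [hlam] with a ha
    obtain ⟨ι, hι⟩ := exists_isIota hs0 hsk ha
    exact ⟨ι, hι.1, hι.isWeakIota⟩
  obtain ⟨ι, hιs, hι⟩ := (Ultrafilter.eventually_exists_mem_iff (Set.finite_Iio s)).1 hex
  rw [Set.mem_Iio] at hιs
  have havg := tendsto_avgTail (s := s) hlim ι
  have hι₀ : IsWeakIota k s lam₀ ι := by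
    refine ⟨hιs, fun h => ?_, ?_⟩
    · exact le_of_tendsto_of_tendsto havg (hlim ι h (by omega))
        (hι.mono fun a ha => ha.2.1 h)
    · exact le_of_tendsto_of_tendsto (hlim (ι + 1) (by omega) (by omega)) havg
        (hι.mono fun a ha => ha.2.2)
  rw [phiS_eq_phiAt hs0 hsk hlam₀ hι₀]
  have hposle : ∀ j, 1 ≤ j → j ≤ s → 0 < lam₀ j := fun j h1 h2 =>
    hpos.trans_le (hlam₀.2 j s h1 h2 hsk)
  have havgpos : 0 < avgTail k s lam₀ ι :=
    (hposle (ι + 1) (by omega) (by omega)).trans_le hι₀.2.2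
  have hlimAt : Tendsto (fun a => phiAt k s (lam a) ι) l (𝓝 (phiAt k s lam₀ ι)) := by
    refine Tendsto.add (tendsto_finsetSum _ fun j hj => ?_) ((havg.log havgpos.ne').const_mul _)
    rw [Finset.mem_Icc] at hj
    exact (hlim j hj.1 (by omega)).log (hposle j hj.1 (by omega)).ne'
  refine hlimAt.congr' ?_
  filter_upwards [hlam, hι] with a ha hιa
  exact (phiS_eq_phiAt hs0 hsk ha hιa).symm

/-- `U` is orthogonal and diagonalizes `X`, with decreasing diagonal `d`. -/
def IsOrderedDiagonalization {k : ℕ} (X U : Matrix (Fin k) (Fin k) ℝ) (d : Fin k → ℝ) : Prop :=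
  Uᵀ * U = 1 ∧ X = U * diagonal d * Uᵀ ∧ Antitone d

namespace IsOrderedDiagonalization

variable {k : ℕ} {X U : Matrix (Fin k) (Fin k) ℝ} {d : Fin k → ℝ}

lemma diagonal_eq (h : IsOrderedDiagonalization X U d) : diagonal d = Uᵀ * X * U := by
  obtain ⟨hU, hX, -⟩ := h
  calc diagonal d = (Uᵀ * U) * diagonal d * (Uᵀ * U) := by rw [hU, one_mul, mul_one]
    _ = Uᵀ * X * U := by rw [hX]; simp only [Matrix.mul_assoc]

lemma eigsDesc_succ (h : IsOrderedDiagonalization X U d) (j : Fin k) :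
    eigsDesc k X (j + 1) = d j := by
  obtain ⟨hU, hX, hd⟩ := h
  have hH : X.IsHermitian := by
    rw [hX, IsHermitian, conjTranspose_eq_transpose_of_trivial]
    simp [Matrix.mul_assoc]
  have hroots : (Finset.univ.val.map hH.eigenvalues) = Finset.univ.val.map d := by
    have h1 : X.charpoly.roots = Finset.univ.val.map hH.eigenvalues := by
      simpa using! hH.roots_charpoly_eq_eigenvalues
    have h2 : X.charpoly = (diagonal d).charpoly := by
      rw [hX, charpoly_mul_comm, ← Matrix.mul_assoc, hU, one_mul]
    rw [← h1, h2, charpoly_diagonal]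
    rw [← Polynomial.roots_multiset_prod_X_sub_C (Finset.univ.val.map d), Multiset.map_map]
    rfl
  have hperm : ((((List.ofFn hH.eigenvalues : List ℝ) : Multiset ℝ).sort (· ≤ ·)).reverse) =
      List.ofFn d := by
    refine List.Perm.eq_of_sortedGE ?_ hd.sortedGE_ofFn ?_
    · exact List.sortedGE_reverse.2 (Multiset.pairwise_sort _ _).sortedLE
    · rw [← Multiset.coe_eq_coe, Multiset.coe_reverse, Multiset.sort_eq]
      simpa [Fin.univ_val_map] using hroots
  rw [eigsDesc, dif_pos hH, hperm]
  simp

lemma isSpectrum (h : IsOrderedDiagonalization X U d) (hX : X.PosSemidef) :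
    IsSpectrum k (eigsDesc k X) := by
  have hd : ∀ j, 0 ≤ d j := by
    rw [← posSemidef_diagonal_iff, h.diagonal_eq]
    simpa using hX.conjTranspose_mul_mul_same U
  have key : ∀ i, 1 ≤ i → i ≤ k → ∃ j : Fin k, (j : ℕ) + 1 = i := fun i h1 h2 =>
    ⟨⟨i - 1, by omega⟩, by simp; omega⟩
  refine ⟨fun i h1 h2 => ?_, fun i j h1 hij h2 => ?_⟩
  · obtain ⟨j, rfl⟩ := key i h1 h2
    rw [h.eigsDesc_succ]
    exact hd j
  · obtain ⟨a, rfl⟩ := key i h1 (hij.trans h2)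
    obtain ⟨b, rfl⟩ := key j (h1.trans hij) h2
    rw [h.eigsDesc_succ, h.eigsDesc_succ]
    exact h.2.2 (Fin.le_def.2 (by omega))

lemma eigsDesc_pos (h : IsOrderedDiagonalization X U d) (hX : X.PosSemidef) {s : ℕ}
    (hs0 : 0 < s) (hsk : s ≤ k) (hrank : s ≤ X.rank) : 0 < eigsDesc k X s := by
  have hspec := h.isSpectrum hX
  refine (hspec.1 s hs0 hsk).lt_of_ne' fun hzero => ?_
  have hle : X.rank ≤ (diagonal d).rank := by
    rw [h.2.1]
    exact (rank_mul_le_left _ _).trans (rank_mul_le_right _ _)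
  have hsub : ∀ j : Fin k, d j ≠ 0 → (j : ℕ) < s - 1 := fun j hj => by
    by_contra! hc
    rw [← h.eigsDesc_succ] at hj
    exact hj (le_antisymm (hzero ▸ hspec.2 s (j + 1) hs0 (by omega) (by omega))
      (hspec.1 _ (by omega) (by omega)))
  have hcard : Fintype.card {j // d j ≠ 0} ≤ s - 1 := by
    simpa using Fintype.card_le_of_injective
      (fun j : {j // d j ≠ 0} => (⟨j.1, hsub j.1 j.2⟩ : Fin (s - 1)))
      (fun a b hab => Subtype.ext (Fin.ext (by simpa using hab)))
  rw [rank_diagonal] at hle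
  omega

end IsOrderedDiagonalization

lemma exists_isOrderedDiagonalization {k : ℕ} {X : Matrix (Fin k) (Fin k) ℝ}
    (hX : X.IsHermitian) : ∃ U d, IsOrderedDiagonalization X U d := by
  let σ : Equiv.Perm (Fin k) := Fin.revPerm.trans (Tuple.sort hX.eigenvalues)
  let V : Matrix (Fin k) (Fin k) ℝ := hX.eigenvectorUnitary
  have hV : Vᵀ * V = 1 := by
    simpa [star_eq_conjTranspose] using Unitary.coe_star_mul_self hX.eigenvectorUnitary
  have hspec : X = V * diagonal hX.eigenvalues * Vᵀ := by
    have := hX.spectral_theorem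
    rw [Unitary.conjStarAlgAut_apply] at this
    simpa [star_eq_conjTranspose] using! this
  refine ⟨V.submatrix id σ, hX.eigenvalues ∘ σ, ?_, ?_, ?_⟩
  · rw [transpose_submatrix, ← submatrix_mul _ _ _ id _ Function.bijective_id, hV,
      submatrix_one_equiv]
  · rw [← submatrix_diagonal_equiv, transpose_submatrix, submatrix_mul_equiv, submatrix_mul_equiv,
      ← hspec, submatrix_id_id]
  · exact fun i j hij => Tuple.monotone_sort hX.eigenvalues (Fin.rev_le_rev.2 hij)

lemma exists_tendsto_of_transpose_mul_self {α : Type*} {k : ℕ} (l : Ultrafilter α)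
    {U : α → Matrix (Fin k) (Fin k) ℝ} (hU : ∀ᶠ a in (l : Filter α), (U a)ᵀ * U a = 1) :
    ∃ U₀, Tendsto U l (𝓝 U₀) := by
  let K : Set (Matrix (Fin k) (Fin k) ℝ) :=
    Set.univ.pi fun _ => Set.univ.pi fun _ => Set.Icc (-1) 1
  have hK : IsCompact K := isCompact_univ_pi fun _ => isCompact_univ_pi fun _ => isCompact_Icc
  have hmem : ∀ᶠ a in (l : Filter α), U a ∈ K := by
    filter_upwards [hU] with a ha i _ j _
    have hunit : U a ∈ unitaryGroup (Fin k) ℝ := by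
      rw [mem_unitaryGroup_iff']
      simpa [star_eq_conjTranspose] using ha
    exact abs_le.1 (entry_norm_bound_of_unitary hunit i j)
  obtain ⟨U₀, -, h⟩ := isCompact_iff_ultrafilter_le_nhds.1 hK (l.map U)
    (le_principal_iff.2 hmem)
  exact ⟨U₀, h⟩

/-- Lemma 2: `Γ_s` is continuous on its domain `{X : X ⪰ 0, rank(X) ≥ s}`. -/
theorem stmt_15 (k s : ℕ) (hs0 : 0 < s) (hsk : s ≤ k) :
    ContinuousOn (gammaS k s)
      {X : Matrix (Fin k) (Fin k) ℝ | X.PosSemidef ∧ s ≤ X.rank} := by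
  intro X₀ hX₀
  rw [ContinuousWithinAt, tendsto_iff_ultrafilter]
  intro l hl
  have hmem : ∀ᶠ X in (l : Filter (Matrix (Fin k) (Fin k) ℝ)), X.PosSemidef ∧ s ≤ X.rank :=
    hl self_mem_nhdsWithin
  have hX : Tendsto id (l : Filter (Matrix (Fin k) (Fin k) ℝ)) (𝓝 X₀) :=
    hl.trans nhdsWithin_le_nhds
  have hex : ∀ X : Matrix (Fin k) (Fin k) ℝ, ∃ U d, X.IsHermitian →
      IsOrderedDiagonalization X U d := fun X => by
    by_cases h : X.IsHermitian
    · obtain ⟨U, d, hUd⟩ := exists_isOrderedDiagonalization h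
      exact ⟨U, d, fun _ => hUd⟩
    · exact ⟨0, 0, fun h' => absurd h' h⟩
  choose U d hUd using hex
  have hdiag : ∀ᶠ X in (l : Filter (Matrix (Fin k) (Fin k) ℝ)),
      IsOrderedDiagonalization X (U X) (d X) := hmem.mono fun X h => hUd X h.1.isHermitian
  obtain ⟨U₀, hU⟩ := exists_tendsto_of_transpose_mul_self l (hdiag.mono fun X h => h.1)
  have hUT : Tendsto (fun X => (U X)ᵀ) l (𝓝 U₀ᵀ) := (continuous_id.matrix_transpose.tendsto U₀).comp hU
  have hd : Tendsto d l (𝓝 (U₀ᵀ * X₀ * U₀).diag) := by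
    refine ((continuous_id.matrix_diag.tendsto _).comp ((hUT.mul hX).mul hU)).congr' ?_
    filter_upwards [hdiag] with X h
    simp only [Function.comp_apply, id, ← h.diagonal_eq, diag_diagonal]
  have hdiag₀ : IsOrderedDiagonalization X₀ U₀ (U₀ᵀ * X₀ * U₀).diag := by
    refine ⟨?_, ?_, fun i j hij => ?_⟩
    · exact tendsto_nhds_unique ((hUT.mul hU).congr' (hdiag.mono fun X h => h.1))
        tendsto_const_nhds
    · exact tendsto_nhds_unique (hX.congr' (hdiag.mono fun X h => h.2.1))
        ((hU.mul ((continuous_id.matrix_diagonal.tendsto _).comp hd)).mul hUT)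
    · exact le_of_tendsto_of_tendsto ((tendsto_pi_nhds.1 hd) j) ((tendsto_pi_nhds.1 hd) i)
        (hdiag.mono fun X h => h.2.2 hij)
  refine tendsto_phiS hs0 hsk l ?_ (hdiag₀.isSpectrum hX₀.1)
    (hdiag₀.eigsDesc_pos hX₀.1 hs0 hsk hX₀.2) fun i h1 h2 => ?_
  · filter_upwards [hmem, hdiag] with X h h'
    exact h'.isSpectrum h.1
  · obtain ⟨j, rfl⟩ : ∃ j : Fin k, (j : ℕ) + 1 = i := ⟨⟨i - 1, by omega⟩, by simp; omega⟩
    rw [hdiag₀.eigsDesc_succ]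
    refine ((tendsto_pi_nhds.1 hd) j).congr' ?_
    filter_upwards [hdiag] with X h
    exact (h.eigsDesc_succ j).symm

end
end

section
/- Let Υ ∈ R^n_{++}, x ∈ dom(f_DDFact;Υ)_+, and d ∈ R^n with x + d ∈ dom(f_DDFact;Υ)_+. Then the one-sided limit lim_{t→0⁺} (f_DDFact(x+td;Υ) − f_DDFact(x;Υ))/t exists and equals (Υ ∘ diag(F Q Diag(β) Q^⊤ F^⊤))^⊤ d − (log Υ)^⊤ d, where F_DDFact(x;Υ) = Q Diag(λ) Q^⊤ is a spectral decomposition with Q orthonormal and λ decreasingly ordered, and β ∈ R^k is given by β_i = 1/λ_i for i ≤ ι and β_i = (s−ι)/Σ_{ℓ=ι+1}^k λ_ℓ for i > ι, ι being the unique integer of Lemma 1 for λ; the value is independent of the choice of F and Q (with β adjusted accordingly). (Proposition on the directional derivative of f_DDFact) -/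
open Matrix
open scoped Matrix BigOperators Classical

noncomputable section

/-- The matrix `Q Diag(a) Qᵀ`. -/
def rotDiag {k : ℕ} (Q : Matrix (Fin k) (Fin k) ℝ) (a : Fin k → ℝ) : Matrix (Fin k) (Fin k) ℝ :=
  Q * Matrix.diagonal a * Qᵀ

/-- The squared inner products of the columns of `Q` with those of `R`. -/
def overlap {k : ℕ} (Q R : Matrix (Fin k) (Fin k) ℝ) (i j : Fin k) : ℝ := ((Qᵀ * R) i j) ^ 2

lemma overlap_nonneg {k : ℕ} (Q R : Matrix (Fin k) (Fin k) ℝ) (i j : Fin k) :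
    0 ≤ overlap Q R i j := sq_nonneg _

lemma trace_rotDiag_mul_rotDiag {k : ℕ} (Q R : Matrix (Fin k) (Fin k) ℝ) (a b : Fin k → ℝ) :
    (rotDiag Q a * rotDiag R b).trace = ∑ i, ∑ j, a i * b j * overlap Q R i j := by
  have h : rotDiag Q a * rotDiag R b
      = Q * (Matrix.diagonal a * (Qᵀ * R) * Matrix.diagonal b * Rᵀ) := by
    simp only [rotDiag, Matrix.mul_assoc]
  have h2 : Rᵀ * Q = (Qᵀ * R)ᵀ := by simp
  rw [h, Matrix.trace_mul_comm, Matrix.mul_assoc, h2]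
  simp only [Matrix.trace, Matrix.diag, Matrix.mul_apply (N := (Qᵀ * R)ᵀ),
    Matrix.mul_diagonal, Matrix.diagonal_mul, Matrix.transpose_apply (Qᵀ * R), overlap]
  exact Finset.sum_congr rfl fun i _ => Finset.sum_congr rfl fun j _ => by ring

lemma sum_overlap_left {k : ℕ} {Q R : Matrix (Fin k) (Fin k) ℝ} (hQ : Q * Qᵀ = 1)
    (hR : R * Rᵀ = 1) (j : Fin k) : ∑ i, overlap Q R i j = 1 := by
  have h : (Qᵀ * R)ᵀ * (Qᵀ * R) = 1 := by
    rw [Matrix.transpose_mul, Matrix.transpose_transpose, Matrix.mul_assoc,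
      ← Matrix.mul_assoc Q, hQ, Matrix.one_mul, mul_eq_one_comm.mp hR]
  have := congrFun (congrFun h j) j
  rw [Matrix.mul_apply, Matrix.one_apply_eq] at this
  rw [← this]
  exact Finset.sum_congr rfl fun i _ => by rw [overlap, Matrix.transpose_apply, sq]

lemma sum_overlap_right {k : ℕ} {Q R : Matrix (Fin k) (Fin k) ℝ} (hQ : Q * Qᵀ = 1)
    (hR : R * Rᵀ = 1) (i : Fin k) : ∑ j, overlap Q R i j = 1 := by
  rw [← sum_overlap_left hR hQ i]
  refine Finset.sum_congr rfl fun j _ => ?_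
  have h : Rᵀ * Q = (Qᵀ * R)ᵀ := by simp
  rw [overlap, overlap, h, Matrix.transpose_apply]

lemma sum_mul_overlap_left {k : ℕ} {Q R : Matrix (Fin k) (Fin k) ℝ} (hQ : Q * Qᵀ = 1)
    (hR : R * Rᵀ = 1) (a : Fin k → ℝ) : ∑ i, ∑ j, a i * overlap Q R i j = ∑ i, a i := by
  simp_rw [← Finset.mul_sum, sum_overlap_right hQ hR, mul_one]

lemma sum_mul_overlap_right {k : ℕ} {Q R : Matrix (Fin k) (Fin k) ℝ} (hQ : Q * Qᵀ = 1)
    (hR : R * Rᵀ = 1) (b : Fin k → ℝ) : ∑ i, ∑ j, b j * overlap Q R i j = ∑ j, b j := by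
  rw [Finset.sum_comm]
  simp_rw [← Finset.mul_sum, sum_overlap_left hQ hR, mul_one]

lemma trace_rotDiag_mul_self {k : ℕ} {Q : Matrix (Fin k) (Fin k) ℝ} (hQ : Q * Qᵀ = 1)
    (a b : Fin k → ℝ) : (rotDiag Q a * rotDiag Q b).trace = ∑ i, a i * b i := by
  have h : rotDiag Q a * rotDiag Q b = Q * (Matrix.diagonal a * Matrix.diagonal b * Qᵀ) := by
    simp only [rotDiag, Matrix.mul_assoc]
    rw [← Matrix.mul_assoc Qᵀ Q, mul_eq_one_comm.mp hQ, Matrix.one_mul]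
  rw [h, Matrix.trace_mul_comm, Matrix.mul_assoc, mul_eq_one_comm.mp hQ, Matrix.mul_one,
    Matrix.diagonal_mul_diagonal, Matrix.trace_diagonal]

lemma rotDiag_transpose {k : ℕ} (Q : Matrix (Fin k) (Fin k) ℝ) (a : Fin k → ℝ) :
    (rotDiag Q a)ᵀ = rotDiag Q a := by
  simp [rotDiag, Matrix.mul_assoc]

/-- The squared Frobenius distance of two symmetric matrices in terms of their spectra. -/
lemma sum_sq_rotDiag_sub {k : ℕ} {Q R : Matrix (Fin k) (Fin k) ℝ} (hQ : Q * Qᵀ = 1)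
    (hR : R * Rᵀ = 1) (a b : Fin k → ℝ) :
    ∑ p, ∑ q, ((rotDiag Q a - rotDiag R b) p q) ^ 2
      = ∑ i, ∑ j, (a i - b j) ^ 2 * overlap Q R i j := by
  have h1 : ∑ p, ∑ q, ((rotDiag Q a - rotDiag R b) p q) ^ 2
      = ((rotDiag Q a - rotDiag R b) * (rotDiag Q a - rotDiag R b)ᵀ).trace := by
    simp only [Matrix.trace, Matrix.diag, Matrix.mul_apply, Matrix.transpose_apply, sq]
  rw [h1, Matrix.transpose_sub, rotDiag_transpose, rotDiag_transpose, sub_mul, mul_sub, mul_sub,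
    Matrix.trace_sub, Matrix.trace_sub, Matrix.trace_sub, Matrix.trace_mul_comm (rotDiag R b)
      (rotDiag Q a), trace_rotDiag_mul_self hQ, trace_rotDiag_mul_self hR,
    trace_rotDiag_mul_rotDiag, ← sum_mul_overlap_left hQ hR fun i => a i * a i,
    ← sum_mul_overlap_right hQ hR fun i => b i * b i]
  simp only [← Finset.sum_sub_distrib]
  exact Finset.sum_congr rfl fun i _ => Finset.sum_congr rfl fun j _ => by ring

/-- `c` is the largest level at which truncating `a` gives total mass `s * c`. -/
structure IsLevel {k : ℕ} (s : ℕ) (a : Fin k → ℝ) (c : ℝ) : Prop where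
  pos : 0 < c
  sum_min : ∑ i, min (a i) c = s * c
  sum_min_lt : ∀ u, c < u → ∑ i, min (a i) u < s * u

/-- The value of `φ_s` in terms of the level `c`. -/
def levelValue {k : ℕ} (a : Fin k → ℝ) (c : ℝ) : ℝ :=
  ∑ i, min (a i) c / c * Real.log (max (a i) c)

/-- The spectrum of the gradient of `Γ_s` in terms of the level `c`. -/
def levelInv {k : ℕ} (a : Fin k → ℝ) (c : ℝ) : Fin k → ℝ := fun i => (max (a i) c)⁻¹

lemma mul_sum_min_le {k s : ℕ} {a : Fin k → ℝ} {c u : ℝ} (ha : ∀ i, 0 ≤ a i)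
    (hc : IsLevel s a c) (hu0 : 0 ≤ u) (hu : u ≤ c) : s * u ≤ ∑ i, min (a i) u := by
  have hcp := hc.pos
  have h1 : s * u = ∑ i, u / c * min (a i) c := by
    rw [← Finset.mul_sum, hc.sum_min]; field_simp
  rw [h1]
  refine Finset.sum_le_sum fun i _ => ?_
  have hr : u / c ≤ 1 := (div_le_one hcp).2 hu
  have hr0 : 0 ≤ u / c := by positivity
  refine le_min ?_ ?_
  · exact (mul_le_mul_of_nonneg_left (min_le_left _ _) hr0).trans
      (mul_le_of_le_one_left (ha i) hr)
  · calc u / c * min (a i) c ≤ u / c * c := mul_le_mul_of_nonneg_left (min_le_right _ _) hr0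
      _ = u := by field_simp

/-- The supergradient inequality for `Γ_s`. -/
lemma levelValue_le {k s : ℕ} {Q R : Matrix (Fin k) (Fin k) ℝ} (hQ : Q * Qᵀ = 1)
    (hR : R * Rᵀ = 1) {a b : Fin k → ℝ} {c e : ℝ} (hb : ∀ i, 0 ≤ b i)
    (hc : IsLevel s a c) (he : IsLevel s b e) :
    levelValue b e ≤ levelValue a c
      + (rotDiag Q (levelInv a c) * (rotDiag R b - rotDiag Q a)).trace := by
  have hcp := hc.pos
  have hep := he.pos
  have hM : ∀ i, 0 < max (a i) c := fun i => lt_max_of_lt_right hcp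
  have hm : ∀ j, 0 < max (b j) e := fun j => lt_max_of_lt_right hep
  set w : Fin k → ℝ := fun j => min (b j) e / e with hw
  have hw0 : ∀ j, 0 ≤ w j := fun j => div_nonneg (le_min (hb j) hep.le) hep.le
  have hw1 : ∀ j, w j ≤ 1 := fun j => (div_le_one hep).2 (min_le_right _ _)
  have hwsum : ∑ j, w j = s := by
    rw [hw, ← Finset.sum_div, he.sum_min]; field_simp
  have hwm : ∀ j, w j * max (b j) e = b j := fun j => by
    have := min_mul_max (b j) e
    simp only [hw]; field_simp; linarith
  set v : Fin k → ℝ := fun i => min (a i) c / c with hv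
  have hvsum : ∑ j, v j = s := by
    rw [hv, ← Finset.sum_div, hc.sum_min]; field_simp
  have hXX : (rotDiag Q (levelInv a c) * rotDiag Q a).trace = s := by
    rw [trace_rotDiag_mul_self hQ, ← hvsum]
    refine Finset.sum_congr rfl fun i _ => ?_
    have := min_mul_max (a i) c
    have := hM i
    simp only [hv, levelInv]; field_simp; linarith
  rw [mul_sub, Matrix.trace_sub, hXX, trace_rotDiag_mul_rotDiag]
  set W := overlap Q R with hW
  have hpt : ∀ i j, w j * Real.log (max (b j) e) * W i j ≤
      (levelInv a c i * b j * W i j - w j * W i j)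
        + w j * W i j * (Real.log (max (a i) c) - Real.log c) + w j * Real.log c * W i j := by
    intro i j
    have h1 := Real.log_le_sub_one_of_pos (mul_pos (inv_pos.2 (hM i)) (hm j))
    rw [Real.log_mul (inv_pos.2 (hM i)).ne' (hm j).ne', Real.log_inv] at h1
    have h2 := mul_le_mul_of_nonneg_left h1 (mul_nonneg (hw0 j) (overlap_nonneg Q R i j))
    have h3 : levelInv a c i * b j * W i j
        = (max (a i) c)⁻¹ * (w j * max (b j) e) * W i j := by rw [hwm]; rfl
    rw [h3]
    simp only [← hW] at h2
    linarith
  have h1 : levelValue b e = ∑ i, ∑ j, w j * Real.log (max (b j) e) * W i j :=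
    (sum_mul_overlap_right hQ hR _).symm
  have h2 : levelValue b e ≤ ((∑ i, ∑ j, levelInv a c i * b j * W i j) - s)
        + (∑ i, ∑ j, w j * W i j * (Real.log (max (a i) c) - Real.log c)) + s * Real.log c := by
    rw [h1]
    refine (Finset.sum_le_sum fun i _ => Finset.sum_le_sum fun j _ => hpt i j).trans_eq ?_
    simp only [Finset.sum_add_distrib, Finset.sum_sub_distrib]
    rw [sum_mul_overlap_right hQ hR w, sum_mul_overlap_right hQ hR fun j => w j * Real.log c,
      ← Finset.sum_mul, hwsum]
  have h3 : ∑ i, ∑ j, w j * W i j * (Real.log (max (a i) c) - Real.log c)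
      ≤ ∑ i, v i * (Real.log (max (a i) c) - Real.log c) := by
    refine Finset.sum_le_sum fun i _ => ?_
    rw [← Finset.sum_mul]
    rcases le_total (a i) c with h | h
    · simp [max_eq_right h]
    · have hl : 0 ≤ Real.log (max (a i) c) - Real.log c :=
        sub_nonneg.2 (Real.log_le_log hcp (le_max_right _ _))
      refine mul_le_mul_of_nonneg_right ?_ hl
      have hvi : v i = 1 := by simp only [hv]; rw [min_eq_right h]; field_simp
      rw [hvi, ← sum_overlap_right hQ hR i]
      exact Finset.sum_le_sum fun j _ =>
        mul_le_of_le_one_left (overlap_nonneg Q R i j) (hw1 j)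
  have h4 : ∑ i, v i * (Real.log (max (a i) c) - Real.log c)
      = levelValue a c - s * Real.log c := by
    simp only [mul_sub, Finset.sum_sub_distrib]
    rw [← Finset.sum_mul, hvsum]; rfl
  linarith

/-- The gradient of the concave function `X ↦ tr min(X, u)`, with spectrum `1` below `u`
and `0` above, gives a global upper bound. -/
lemma sum_min_le_add_trace {k : ℕ} {Q R : Matrix (Fin k) (Fin k) ℝ} (hQ : Q * Qᵀ = 1)
    (hR : R * Rᵀ = 1) (a b : Fin k → ℝ) (u : ℝ) :
    ∑ j, min (b j) u ≤ ∑ i, min (a i) u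
      + (rotDiag Q (fun i => if a i ≤ u then 1 else 0) * (rotDiag R b - rotDiag Q a)).trace := by
  set p : Fin k → ℝ := fun i => if a i ≤ u then 1 else 0 with hp
  rw [mul_sub, Matrix.trace_sub, trace_rotDiag_mul_self hQ, trace_rotDiag_mul_rotDiag,
    ← sum_mul_overlap_right hQ hR]
  have h1 : ∑ i, min (a i) u - ∑ i, p i * a i = ∑ i, (1 - p i) * u := by
    rw [← Finset.sum_sub_distrib]
    refine Finset.sum_congr rfl fun i _ => ?_
    by_cases h : a i ≤ u
    · simp [hp, h]
    · simp [hp, h, min_eq_right (not_le.1 h).le]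
  have h2 : ∑ i, ∑ j, min (b j) u * overlap Q R i j ≤
      ∑ i, ∑ j, (p i * b j * overlap Q R i j + (1 - p i) * u * overlap Q R i j) := by
    refine Finset.sum_le_sum fun i _ => Finset.sum_le_sum fun j _ => ?_
    rw [← add_mul]
    refine mul_le_mul_of_nonneg_right ?_ (overlap_nonneg Q R i j)
    by_cases h : a i ≤ u <;> simp [hp, h]
  simp only [Finset.sum_add_distrib] at h2
  rw [sum_mul_overlap_left hQ hR fun i => (1 - p i) * u] at h2
  linarith

/-- The gradients of `Γ_s` depend continuously on the matrix and on the level. -/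
lemma sum_sq_rotDiag_levelInv_sub_le {k : ℕ} {Q R : Matrix (Fin k) (Fin k) ℝ} (hQ : Q * Qᵀ = 1)
    (hR : R * Rᵀ = 1) (a b : Fin k → ℝ) {c e : ℝ} (hc : 0 < c) (he : 0 < e) :
    ∑ p, ∑ q, ((rotDiag Q (levelInv a c) - rotDiag R (levelInv b e)) p q) ^ 2
      ≤ (2 * ∑ p, ∑ q, ((rotDiag Q a - rotDiag R b) p q) ^ 2 + 2 * (k * (c - e) ^ 2))
        / (c * e) ^ 2 := by
  have hk : (k : ℝ) * (c - e) ^ 2 = ∑ i, ∑ j, (c - e) ^ 2 * overlap Q R i j := by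
    rw [sum_mul_overlap_left hQ hR fun _ => (c - e) ^ 2]; simp
  rw [sum_sq_rotDiag_sub hQ hR, sum_sq_rotDiag_sub hQ hR, hk, le_div_iff₀ (by positivity)]
  simp only [Finset.mul_sum, Finset.sum_mul, ← Finset.sum_add_distrib]
  refine Finset.sum_le_sum fun i _ => Finset.sum_le_sum fun j _ => ?_
  have hW := overlap_nonneg Q R i j
  suffices h : (levelInv a c i - levelInv b e j) ^ 2 * (c * e) ^ 2
      ≤ 2 * (a i - b j) ^ 2 + 2 * (c - e) ^ 2 by
    nlinarith [mul_le_mul_of_nonneg_right h hW]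
  set M := max (a i) c with hM
  set m := max (b j) e with hm
  have hcM : c ≤ M := le_max_right _ _
  have hem : e ≤ m := le_max_right _ _
  have hMp : 0 < M := hc.trans_le hcM
  have hmp : 0 < m := he.trans_le hem
  have h1 : levelInv a c i - levelInv b e j = (m - M) / (M * m) := by
    simp only [levelInv, ← hM, ← hm]; field_simp
  have h2 : |M - m| ≤ max |a i - b j| |c - e| := abs_max_sub_max_le_max _ _ _ _
  have h3 : (M - m) ^ 2 ≤ (a i - b j) ^ 2 + (c - e) ^ 2 := by
    rcases le_max_iff.1 h2 with h | h
    · nlinarith [sq_le_sq.2 h, sq_nonneg (c - e)]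
    · nlinarith [sq_le_sq.2 h, sq_nonneg (a i - b j)]
  have h4 : ((m - M) / (M * m)) ^ 2 * (c * e) ^ 2 ≤ (m - M) ^ 2 := by
    rw [div_pow, div_mul_eq_mul_div]
    refine div_le_of_le_mul₀ (by positivity) (by positivity) ?_
    gcongr
  rw [h1]
  nlinarith [sq_nonneg (a i - b j), sq_nonneg (c - e)]

lemma sum_fin_eq_sum_Icc_add {k m : ℕ} (hm : m ≤ k) (f : ℕ → ℝ) :
    ∑ j : Fin k, f (j + 1) = ∑ l ∈ Finset.Icc 1 m, f l + ∑ l ∈ Finset.Icc (m + 1) k, f l := by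
  have hIco : ∀ a b : ℕ, Finset.Icc a b = Finset.Ico a (b + 1) := fun a b => by ext; simp
  rw [Fin.sum_univ_eq_sum_range fun j => f (j + 1), Finset.range_eq_Ico, Finset.sum_Ico_add',
    hIco, hIco, Finset.sum_Ico_consecutive _ (by omega) (by omega)]

lemma exists_isIota_s17 {k s : ℕ} {lam : ℕ → ℝ} (hs : 0 < s) (hsk : s ≤ k) (h0 : ∀ i, 0 ≤ lam i) :
    ∃ m, IsIota k s lam m := by
  have hsplit : ∀ m, m < s → ∑ l ∈ Finset.Icc (m + 1) k, lam l
      = lam (m + 1) + ∑ l ∈ Finset.Icc (m + 1 + 1) k, lam l := fun m hm => by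
    rw [← Finset.add_sum_Ioc_eq_sum_Icc (by omega : m + 1 ≤ k)]
    congr 2
    ext
    simp only [Finset.mem_Ioc, Finset.mem_Icc]
    omega
  have hP : ∃ m, m < s ∧ lam (m + 1) ≤ avgTail k s lam m := by
    refine ⟨s - 1, by omega, ?_⟩
    have h1 : (s : ℝ) - ((s - 1 : ℕ) : ℝ) = 1 := by
      rw [Nat.cast_sub hs]; simp
    rw [avgTail, h1, div_one, hsplit _ (by omega)]
    exact le_add_of_nonneg_right (Finset.sum_nonneg fun i _ => h0 i)
  obtain ⟨h1, h2⟩ := Nat.find_spec hP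
  refine ⟨Nat.find hP, h1, fun hm => ?_, h2⟩
  obtain ⟨m, hm'⟩ : ∃ m, Nat.find hP = m + 1 := ⟨Nat.find hP - 1, by omega⟩
  have h3 := Nat.find_min hP (m := m) (by omega)
  rw [hm'] at h1 ⊢
  have hpos : (0 : ℝ) < (s : ℝ) - ((m + 1 : ℕ) : ℝ) := sub_pos.2 (by exact_mod_cast h1)
  have h4 : avgTail k s lam m < lam (m + 1) := by
    by_contra h
    exact h3 ⟨by omega, not_lt.1 h⟩
  push_cast at hpos
  rw [avgTail, hsplit m (by omega), div_lt_iff₀ (by linarith)] at h4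
  rw [avgTail, div_lt_iff₀ (by push_cast; exact hpos)]
  push_cast
  linarith

/-- The level of a decreasing sequence is its tail average at the index `ι`. -/
def levelOf (k s : ℕ) (lam : ℕ → ℝ) : ℝ := avgTail k s lam (iotaOf k s lam)

section Level

variable {k s : ℕ} {lam : ℕ → ℝ}

lemma isIota_iotaOf (hs : 0 < s) (hsk : s ≤ k) (h0 : ∀ i, 0 ≤ lam i) :
    IsIota k s lam (iotaOf k s lam) := by
  have h := exists_isIota_s17 hs hsk h0
  rw [iotaOf, dif_pos h]
  exact h.choose_spec

lemma levelOf_lt (hs : 0 < s) (hsk : s ≤ k) (h0 : ∀ i, 0 ≤ lam i)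
    (hanti : ∀ i j, 1 ≤ i → i ≤ j → j ≤ k → lam j ≤ lam i) {l : ℕ} (hl : 1 ≤ l)
    (hle : l ≤ iotaOf k s lam) : levelOf k s lam < lam l := by
  obtain ⟨h1, h2, -⟩ := isIota_iotaOf hs hsk h0
  exact (h2 (by omega)).trans_le (hanti l _ hl hle (by omega))

lemma le_levelOf (hs : 0 < s) (hsk : s ≤ k) (h0 : ∀ i, 0 ≤ lam i)
    (hanti : ∀ i j, 1 ≤ i → i ≤ j → j ≤ k → lam j ≤ lam i) {l : ℕ}
    (hlt : iotaOf k s lam < l) (hl : l ≤ k) : lam l ≤ levelOf k s lam := by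
  obtain ⟨-, -, h3⟩ := isIota_iotaOf hs hsk h0
  exact (hanti _ l (by omega) (by omega) hl).trans h3

lemma sum_tail_eq (hs : 0 < s) (hsk : s ≤ k) (h0 : ∀ i, 0 ≤ lam i) :
    ∑ l ∈ Finset.Icc (iotaOf k s lam + 1) k, lam l
      = (s - iotaOf k s lam) * levelOf k s lam := by
  have h1 := (isIota_iotaOf hs hsk h0).1
  have : (0 : ℝ) < (s : ℝ) - iotaOf k s lam := sub_pos.2 (by exact_mod_cast h1)
  rw [levelOf, avgTail]
  field_simp

lemma levelOf_pos (hs : 0 < s) (hsk : s ≤ k) (h0 : ∀ i, 0 ≤ lam i)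
    (hanti : ∀ i j, 1 ≤ i → i ≤ j → j ≤ k → lam j ≤ lam i) (hpos : 0 < lam s) :
    0 < levelOf k s lam :=
  hpos.trans_le (le_levelOf hs hsk h0 hanti (isIota_iotaOf hs hsk h0).1 hsk)

lemma isLevel_levelOf (hs : 0 < s) (hsk : s ≤ k) (h0 : ∀ i, 0 ≤ lam i)
    (hanti : ∀ i j, 1 ≤ i → i ≤ j → j ≤ k → lam j ≤ lam i) (hpos : 0 < lam s) :
    IsLevel s (fun j : Fin k => lam (j + 1)) (levelOf k s lam) := by
  have hι := (isIota_iotaOf hs hsk h0).1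
  have hιk : iotaOf k s lam ≤ k := by omega
  have htail := sum_tail_eq hs hsk h0
  refine ⟨levelOf_pos hs hsk h0 hanti hpos, ?_, fun u hu => ?_⟩
  · rw [sum_fin_eq_sum_Icc_add hιk fun l => min (lam l) (levelOf k s lam),
      Finset.sum_congr rfl fun l hl => min_eq_right (levelOf_lt hs hsk h0 hanti
        (Finset.mem_Icc.1 hl).1 (Finset.mem_Icc.1 hl).2).le,
      Finset.sum_congr (s₁ := Finset.Icc (iotaOf k s lam + 1) k) rfl fun l hl =>
        min_eq_left (le_levelOf hs hsk h0 hanti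
        (Finset.mem_Icc.1 hl).1 (Finset.mem_Icc.1 hl).2), htail]
    simp only [Finset.sum_const, Nat.card_Icc, Nat.add_sub_cancel, nsmul_eq_mul]
    ring
  · rw [sum_fin_eq_sum_Icc_add hιk fun l => min (lam l) u]
    have h1 : ∑ l ∈ Finset.Icc 1 (iotaOf k s lam), min (lam l) u ≤ iotaOf k s lam * u := by
      refine (Finset.sum_le_sum fun l _ => min_le_right _ _).trans_eq ?_
      simp
    have h2 : ∑ l ∈ Finset.Icc (iotaOf k s lam + 1) k, min (lam l) u
        ≤ (s - iotaOf k s lam) * levelOf k s lam :=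
      htail ▸ Finset.sum_le_sum fun l _ => min_le_left _ _
    have h3 : (0 : ℝ) < (s : ℝ) - iotaOf k s lam := sub_pos.2 (by exact_mod_cast hι)
    nlinarith [mul_lt_mul_of_pos_left hu h3]

lemma phiS_eq_levelValue (hs : 0 < s) (hsk : s ≤ k) (h0 : ∀ i, 0 ≤ lam i)
    (hanti : ∀ i j, 1 ≤ i → i ≤ j → j ≤ k → lam j ≤ lam i) (hpos : 0 < lam s) :
    phiS k s lam = levelValue (fun j : Fin k => lam (j + 1)) (levelOf k s lam) := by
  have hιk : iotaOf k s lam ≤ k := (isIota_iotaOf hs hsk h0).1.le.trans hsk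
  have hc := levelOf_pos hs hsk h0 hanti hpos
  rw [levelValue, sum_fin_eq_sum_Icc_add hιk fun l => min (lam l) (levelOf k s lam)
    / levelOf k s lam * Real.log (max (lam l) (levelOf k s lam)), phiS]
  congr 1
  · refine Finset.sum_congr rfl fun l hl => ?_
    have h := (levelOf_lt hs hsk h0 hanti (Finset.mem_Icc.1 hl).1 (Finset.mem_Icc.1 hl).2).le
    rw [min_eq_right h, max_eq_left h, div_self hc.ne', one_mul]
  · have h1 : ∀ l ∈ Finset.Icc (iotaOf k s lam + 1) k, min (lam l) (levelOf k s lam)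
        / levelOf k s lam * Real.log (max (lam l) (levelOf k s lam))
        = lam l * (Real.log (levelOf k s lam) / levelOf k s lam) := fun l hl => by
      have h := le_levelOf hs hsk h0 hanti (Finset.mem_Icc.1 hl).1 (Finset.mem_Icc.1 hl).2
      rw [min_eq_left h, max_eq_right h]; ring
    rw [Finset.sum_congr rfl h1, ← Finset.sum_mul, sum_tail_eq hs hsk h0]
    change _ * Real.log (levelOf k s lam) = _
    field_simp

lemma betaOf_eq_levelInv (hs : 0 < s) (hsk : s ≤ k) (h0 : ∀ i, 0 ≤ lam i)
    (hanti : ∀ i j, 1 ≤ i → i ≤ j → j ≤ k → lam j ≤ lam i) :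
    betaOf k s lam = levelInv (fun j : Fin k => lam (j + 1)) (levelOf k s lam) := by
  funext j
  rw [betaOf, levelInv]
  split_ifs with h
  · rw [max_eq_left (levelOf_lt hs hsk h0 hanti (by omega) h).le]
  · rw [max_eq_right (le_levelOf hs hsk h0 hanti (by omega) (by omega)), levelOf, avgTail,
      inv_div]

/-- If the truncated mass reaches `s * u` at some `u > 0`, at least `s` entries are positive. -/
lemma pos_of_mul_le_sum_min (hs : 0 < s) (hsk : s ≤ k)
    (hanti : ∀ i j, 1 ≤ i → i ≤ j → j ≤ k → lam j ≤ lam i) {u : ℝ} (hu : 0 < u)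
    (h : s * u ≤ ∑ j : Fin k, min (lam (j + 1)) u) : 0 < lam s := by
  by_contra hneg
  rw [sum_fin_eq_sum_Icc_add (m := s - 1) (by omega) fun l => min (lam l) u] at h
  have h1 : ∑ l ∈ Finset.Icc 1 (s - 1), min (lam l) u ≤ ((s - 1 : ℕ) : ℝ) * u := by
    refine (Finset.sum_le_sum fun l _ => min_le_right _ _).trans_eq ?_
    simp
  have h2 : ∑ l ∈ Finset.Icc (s - 1 + 1) k, min (lam l) u ≤ 0 :=
    Finset.sum_nonpos fun l hl => by
      rw [Finset.mem_Icc] at hl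
      exact (min_le_left _ _).trans ((hanti s l hs (by omega) hl.2).trans (not_lt.1 hneg))
  rw [Nat.cast_sub hs] at h1
  push_cast at h1
  linarith

end Level

lemma pos_of_le_rank {k s : ℕ} {Q : Matrix (Fin k) (Fin k) ℝ} {lam : ℕ → ℝ} (hs : 0 < s)
    (h0 : ∀ i, 0 ≤ lam i) (hanti : ∀ i j, 1 ≤ i → i ≤ j → j ≤ k → lam j ≤ lam i)
    (hrank : s ≤ (rotDiag Q fun j => lam (j + 1)).rank) : 0 < lam s := by
  have h1 : s ≤ (Matrix.diagonal fun j : Fin k => lam (j + 1)).rank :=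
    hrank.trans ((Matrix.rank_mul_le_left _ _).trans (Matrix.rank_mul_le_right _ _))
  rw [Matrix.rank_diagonal] at h1
  by_contra hneg
  have h2 : Fintype.card {i : Fin k // lam (i + 1) ≠ 0} ≤ Fintype.card (Fin (s - 1)) := by
    refine Fintype.card_le_of_injective (fun i => ⟨i.1, ?_⟩) fun i j hij => ?_
    · by_contra hi
      have := hanti s (i.1 + 1) hs (by omega) (by omega)
      exact i.2 (le_antisymm (this.trans (not_lt.1 hneg)) (h0 _))
    · exact Subtype.ext (Fin.ext (by simpa using hij))
  rw [Fintype.card_fin] at h2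
  omega

lemma exists_perm_of_perm_ofFn {k : ℕ} {f g : Fin k → ℝ}
    (h : (List.ofFn f).Perm (List.ofFn g)) : ∃ σ : Equiv.Perm (Fin k), f = g ∘ σ := by
  have hfg : List.ofFn (f ∘ Tuple.sort f) = List.ofFn (g ∘ Tuple.sort g) :=
    List.Perm.eq_of_sortedLE (Tuple.monotone_sort f).sortedLE_ofFn
      (Tuple.monotone_sort g).sortedLE_ofFn
      (((Tuple.sort f).ofFn_comp_perm f).trans (h.trans ((Tuple.sort g).ofFn_comp_perm g).symm))
  refine ⟨(Tuple.sort f).symm.trans (Tuple.sort g), funext fun i => ?_⟩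
  simpa using congrFun (List.ofFn_injective hfg) ((Tuple.sort f).symm i)

/-- `eigsDesc` is the spectrum in an ordered spectral decomposition. -/
lemma exists_rotDiag_eigsDesc {k : ℕ} {X : Matrix (Fin k) (Fin k) ℝ} (hX : X.PosSemidef) :
    (∃ R : Matrix (Fin k) (Fin k) ℝ, R * Rᵀ = 1 ∧ X = rotDiag R fun j => eigsDesc k X (j + 1)) ∧
    (∀ i, 0 ≤ eigsDesc k X i) ∧
    ∀ i j, 1 ≤ i → i ≤ j → j ≤ k → eigsDesc k X j ≤ eigsDesc k X i := by
  have hH := hX.isHermitian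
  set L : List ℝ := (((List.ofFn hH.eigenvalues : List ℝ) : Multiset ℝ).sort (· ≤ ·)).reverse
    with hL
  have heig : ∀ i, eigsDesc k X i = L.getD (i - 1) 0 := fun i => by
    rw [eigsDesc, dif_pos hH]
  have hperm : (L : Multiset ℝ) = (List.ofFn hH.eigenvalues : List ℝ) := by
    rw [hL, Multiset.coe_reverse, Multiset.sort_eq]
  have hlen : L.length = k := by
    have := congrArg Multiset.card hperm
    simpa using this
  have hsorted : L.Pairwise (· ≥ ·) := by
    rw [hL, List.pairwise_reverse]
    exact Multiset.pairwise_sort _ _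
  refine ⟨?_, fun i => ?_, fun i j hi hij hj => ?_⟩
  · have hofFn : List.ofFn (fun j : Fin k => eigsDesc k X (j + 1)) = L := by
      refine List.ext_getElem (by simp [hlen]) fun i h1 h2 => ?_
      simp [heig, h2]
    obtain ⟨σ, hσ⟩ : ∃ σ : Equiv.Perm (Fin k),
        (fun j : Fin k => eigsDesc k X (j + 1)) = hH.eigenvalues ∘ σ := by
      apply exists_perm_of_perm_ofFn
      rw [hofFn]
      exact Multiset.coe_eq_coe.1 hperm
    set U : Matrix (Fin k) (Fin k) ℝ := (hH.eigenvectorUnitary : Matrix (Fin k) (Fin k) ℝ)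
    have hU : U * Uᵀ = 1 := by
      have := Unitary.mul_star_self_of_mem hH.eigenvectorUnitary.2
      simpa [Matrix.star_eq_conjTranspose, Matrix.conjTranspose_eq_transpose_of_trivial] using this
    have hspec : X = U * Matrix.diagonal hH.eigenvalues * Uᵀ := by
      have := hH.spectral_theorem
      simpa [Unitary.conjStarAlgAut_apply, Matrix.star_eq_conjTranspose,
        Matrix.conjTranspose_eq_transpose_of_trivial, Function.comp_def] using this
    refine ⟨U.submatrix id σ, ?_, ?_⟩
    · rw [Matrix.transpose_submatrix, Matrix.submatrix_mul_equiv, hU, Matrix.submatrix_id_id]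
    · have hd : Matrix.diagonal (hH.eigenvalues ∘ σ)
          = (Matrix.diagonal hH.eigenvalues).submatrix σ σ :=
        (Matrix.submatrix_diagonal_equiv _ σ).symm
      rw [hσ, rotDiag, hd, Matrix.transpose_submatrix, Matrix.submatrix_mul_equiv,
        Matrix.submatrix_mul_equiv, Matrix.submatrix_id_id]
      exact hspec
  · rw [heig]
    rcases lt_or_ge (i - 1) L.length with h | h
    · rw [List.getD_eq_getElem _ _ h]
      have hmem : L[i - 1] ∈ (L : Multiset ℝ) := Multiset.mem_coe.2 (List.getElem_mem h)
      rw [hperm, Multiset.mem_coe, List.mem_ofFn] at hmem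
      obtain ⟨m, hm⟩ := hmem
      rw [← hm]
      exact hX.eigenvalues_nonneg m
    · rw [List.getD_eq_default _ _ h]
  · rw [heig, heig, List.getD_eq_getElem _ _ (by omega), List.getD_eq_getElem _ _ (by omega)]
    rcases hij.eq_or_lt with rfl | h
    · exact le_rfl
    · exact List.pairwise_iff_getElem.1 hsorted _ _ (by omega) (by omega) (by omega)

lemma FDD_add_smul {n k : ℕ} (F : Matrix (Fin n) (Fin k) ℝ) (x d Υ : Fin n → ℝ) (t : ℝ) :
    FDD n k F (x + t • d) Υ = FDD n k F x Υ + t • FDD n k F d Υ := by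
  have h : Matrix.diagonal (fun i => Υ i * (x + t • d) i)
      = Matrix.diagonal (fun i => Υ i * x i) + t • Matrix.diagonal (fun i => Υ i * d i) := by
    rw [← Matrix.diagonal_smul, Matrix.diagonal_add]
    congr 1
    funext i
    simp only [Pi.add_apply, Pi.smul_apply, smul_eq_mul]
    ring
  simp only [FDD, h, Matrix.mul_add, Matrix.add_mul, Matrix.mul_smul, Matrix.smul_mul]

lemma posSemidef_FDD {n k : ℕ} (F : Matrix (Fin n) (Fin k) ℝ) {x Υ : Fin n → ℝ}
    (hΥ : ∀ i, 0 < Υ i) (hx : ∀ i, 0 ≤ x i) : (FDD n k F x Υ).PosSemidef := by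
  have h : (Matrix.diagonal fun i => Υ i * x i).PosSemidef :=
    Matrix.PosSemidef.diagonal fun i => mul_nonneg (hΥ i).le (hx i)
  have := h.conjTranspose_mul_mul_same F
  rwa [Matrix.conjTranspose_eq_transpose_of_trivial] at this

lemma trace_rotDiag_mul_FDD {n k : ℕ} (F : Matrix (Fin n) (Fin k) ℝ)
    (Q : Matrix (Fin k) (Fin k) ℝ) (b : Fin k → ℝ) (d Υ : Fin n → ℝ) :
    (rotDiag Q b * FDD n k F d Υ).trace
      = ∑ i, Υ i * d i * (F * Q * Matrix.diagonal b * Qᵀ * Fᵀ) i i := by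
  have h1 : rotDiag Q b * FDD n k F d Υ
      = (rotDiag Q b * Fᵀ * Matrix.diagonal (fun i => Υ i * d i)) * F := by
    simp only [FDD, Matrix.mul_assoc]
  have h2 : F * (rotDiag Q b * Fᵀ * Matrix.diagonal (fun i => Υ i * d i))
      = (F * Q * Matrix.diagonal b * Qᵀ * Fᵀ) * Matrix.diagonal (fun i => Υ i * d i) := by
    simp only [rotDiag, Matrix.mul_assoc]
  rw [h1, Matrix.trace_mul_comm, h2]
  simp only [Matrix.trace, Matrix.diag, Matrix.mul_diagonal]
  exact Finset.sum_congr rfl fun i _ => mul_comm _ _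

/-- Along `A + t • D`, with `A + D` positive semidefinite, truncated masses drop at most by the
factor `1 - t`. -/
lemma mul_le_sum_min_of_add_smul {k s : ℕ} {Q R : Matrix (Fin k) (Fin k) ℝ} (hQ : Q * Qᵀ = 1)
    (hR : R * Rᵀ = 1) {a b : Fin k → ℝ} {c t u : ℝ} {D : Matrix (Fin k) (Fin k) ℝ}
    (ha : ∀ i, 0 ≤ a i) (hc : IsLevel s a c) (ht0 : 0 ≤ t) (ht1 : t < 1)
    (hD : (rotDiag Q a + D).PosSemidef) (hb : rotDiag R b = rotDiag Q a + t • D)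
    (hu0 : 0 ≤ u) (hu : u ≤ (1 - t) * c) : s * u ≤ ∑ j, min (b j) u := by
  have ht : 0 < 1 - t := by linarith
  set p : Fin k → ℝ := fun i => if b i ≤ u then 1 else 0 with hp
  obtain ⟨⟨S, hS, hSD⟩, hν, -⟩ := exists_rotDiag_eigsDesc hD
  have h1 : (1 - t) • rotDiag Q a = rotDiag Q fun i => (1 - t) * a i := by
    have : (fun i => (1 - t) * a i) = (1 - t) • a := rfl
    rw [rotDiag, rotDiag, this, Matrix.diagonal_smul, Matrix.mul_smul, Matrix.smul_mul]
  have h2 : rotDiag Q (fun i => (1 - t) * a i) - rotDiag R b = -(t • (rotDiag Q a + D)) := by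
    rw [← h1, hb]; module
  have h3 := sum_min_le_add_trace hR hQ b (fun i => (1 - t) * a i) u
  have h4 : 0 ≤ (rotDiag R p * (rotDiag Q a + D)).trace := by
    rw [hSD, trace_rotDiag_mul_rotDiag]
    refine Finset.sum_nonneg fun i _ => Finset.sum_nonneg fun j _ =>
      mul_nonneg (mul_nonneg ?_ (hν _)) (overlap_nonneg _ _ _ _)
    simp only [hp]
    split_ifs <;> norm_num
  rw [h2, mul_neg, Matrix.trace_neg, Matrix.mul_smul, Matrix.trace_smul, smul_eq_mul] at h3
  have h5 := mul_sum_min_le (u := u / (1 - t)) ha hc (by positivity)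
    ((div_le_iff₀ ht).2 (by linarith))
  have h6 : ∑ i, min ((1 - t) * a i) u = (1 - t) * ∑ i, min (a i) (u / (1 - t)) := by
    rw [Finset.mul_sum]
    refine Finset.sum_congr rfl fun i _ => ?_
    rw [mul_min_of_nonneg _ _ ht.le, mul_div_cancel₀ _ ht.ne']
  have h7 : s * u = (1 - t) * (s * (u / (1 - t))) := by field_simp
  have h8 := mul_le_mul_of_nonneg_left h5 ht.le
  have h9 := mul_nonneg ht0 h4
  linarith

/-- The truncation level is determined by the matrix and depends continuously on it. -/
lemma tendsto_level {k s : ℕ} {Q : Matrix (Fin k) (Fin k) ℝ} (hQ : Q * Qᵀ = 1)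
    {a : Fin k → ℝ} {c : ℝ} {D : Matrix (Fin k) (Fin k) ℝ}
    (ha : ∀ i, 0 ≤ a i) (hc : IsLevel s a c) (hD : (rotDiag Q a + D).PosSemidef)
    {R : ℝ → Matrix (Fin k) (Fin k) ℝ} {b : ℝ → Fin k → ℝ} {e : ℝ → ℝ}
    (h : ∀ t ∈ Set.Ioo (0 : ℝ) 1, R t * (R t)ᵀ = 1 ∧ rotDiag (R t) (b t) = rotDiag Q a + t • D ∧
      (∀ i, 0 ≤ b t i) ∧ IsLevel s (b t) (e t)) :
    Filter.Tendsto e (nhdsWithin 0 (Set.Ioi 0)) (nhds c) := by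
  have hIoo : ∀ᶠ t in nhdsWithin (0 : ℝ) (Set.Ioi 0), t ∈ Set.Ioo (0 : ℝ) 1 :=
    Ioo_mem_nhdsGT one_pos
  rw [tendsto_order]
  constructor
  · intro l hl
    have h1 : Filter.Tendsto (fun t : ℝ => (1 - t) * c) (nhdsWithin 0 (Set.Ioi 0)) (nhds c) := by
      have : Filter.Tendsto (fun t : ℝ => (1 - t) * c) (nhds 0) (nhds ((1 - 0) * c)) :=
        Continuous.tendsto (by fun_prop) 0
      rw [sub_zero, one_mul] at this
      exact this.mono_left nhdsWithin_le_nhds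
    filter_upwards [hIoo, h1.eventually_const_lt hl] with t ht htl
    obtain ⟨hR, hb, hb0, he⟩ := h t ht
    refine htl.trans_le (not_lt.1 fun hlt => ?_)
    exact (he.sum_min_lt _ hlt).not_ge (mul_le_sum_min_of_add_smul hQ hR ha hc ht.1.le ht.2 hD hb
      (mul_nonneg (by linarith [ht.2]) hc.pos.le) le_rfl)
  · intro u hu
    set P := rotDiag Q (fun i => if a i ≤ u then 1 else 0)
    have h1 : Filter.Tendsto (fun t : ℝ => ∑ i, min (a i) u + t * (P * D).trace)
        (nhdsWithin 0 (Set.Ioi 0)) (nhds (∑ i, min (a i) u)) := by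
      have : Filter.Tendsto (fun t : ℝ => ∑ i, min (a i) u + t * (P * D).trace) (nhds 0)
          (nhds (∑ i, min (a i) u + 0 * (P * D).trace)) := Continuous.tendsto (by fun_prop) 0
      rw [zero_mul, add_zero] at this
      exact this.mono_left nhdsWithin_le_nhds
    filter_upwards [hIoo, h1.eventually_lt_const (hc.sum_min_lt u hu)] with t ht htu
    obtain ⟨hR, hb, hb0, he⟩ := h t ht
    by_contra hle
    have h2 := mul_sum_min_le hb0 he (hc.pos.le.trans hu.le) (not_lt.1 hle)
    have h3 := sum_min_le_add_trace hQ hR a (b t) u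
    rw [hb, add_sub_cancel_left, Matrix.mul_smul, Matrix.trace_smul, smul_eq_mul] at h3
    linarith

/-- The gradients of `Γ_s` converge along a ray. -/
lemma tendsto_rotDiag_levelInv {k s : ℕ} {Q : Matrix (Fin k) (Fin k) ℝ} (hQ : Q * Qᵀ = 1)
    {a : Fin k → ℝ} {c : ℝ} {D : Matrix (Fin k) (Fin k) ℝ}
    (ha : ∀ i, 0 ≤ a i) (hc : IsLevel s a c) (hD : (rotDiag Q a + D).PosSemidef)
    {R : ℝ → Matrix (Fin k) (Fin k) ℝ} {b : ℝ → Fin k → ℝ} {e : ℝ → ℝ}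
    (h : ∀ t ∈ Set.Ioo (0 : ℝ) 1, R t * (R t)ᵀ = 1 ∧ rotDiag (R t) (b t) = rotDiag Q a + t • D ∧
      (∀ i, 0 ≤ b t i) ∧ IsLevel s (b t) (e t)) :
    Filter.Tendsto (fun t => rotDiag (R t) (levelInv (b t) (e t))) (nhdsWithin 0 (Set.Ioi 0))
      (nhds (rotDiag Q (levelInv a c))) := by
  have hIoo : ∀ᶠ t in nhdsWithin (0 : ℝ) (Set.Ioi 0), t ∈ Set.Ioo (0 : ℝ) 1 :=
    Ioo_mem_nhdsGT one_pos
  have he := tendsto_level hQ ha hc hD h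
  have hid : Filter.Tendsto (fun t : ℝ => t) (nhdsWithin 0 (Set.Ioi 0)) (nhds 0) :=
    nhdsWithin_le_nhds
  set K := ∑ p, ∑ q, (D p q) ^ 2 with hK
  have hbound : Filter.Tendsto (fun t : ℝ =>
      (2 * (t ^ 2 * K) + 2 * (k * (c - e t) ^ 2)) / (c * e t) ^ 2)
      (nhdsWithin 0 (Set.Ioi 0)) (nhds 0) := by
    have hne : (c * c) ^ 2 ≠ 0 := by have := hc.pos; positivity
    have hdiv := ((((hid.pow 2).mul_const K).const_mul 2).add
      ((((he.const_sub c).pow 2).const_mul (k : ℝ)).const_mul 2)).div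
      ((he.const_mul c).pow 2) hne
    have h0 : (2 * (0 ^ 2 * K) + 2 * (k * (c - c) ^ 2)) / (c * c) ^ 2 = (0 : ℝ) := by simp
    rwa [h0] at hdiv
  have hentry : ∀ p q, Filter.Tendsto
      (fun t => rotDiag (R t) (levelInv (b t) (e t)) p q) (nhdsWithin 0 (Set.Ioi 0))
      (nhds (rotDiag Q (levelInv a c) p q)) := by
    intro p q
    have hsq : Filter.Tendsto (fun t => (rotDiag Q (levelInv a c) p q
        - rotDiag (R t) (levelInv (b t) (e t)) p q) ^ 2) (nhdsWithin 0 (Set.Ioi 0)) (nhds 0) := by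
      refine squeeze_zero' (Filter.Eventually.of_forall fun t => sq_nonneg _) ?_ hbound
      filter_upwards [hIoo] with t ht
      obtain ⟨hR, hb, hb0, hl⟩ := h t ht
      have h1 := sum_sq_rotDiag_levelInv_sub_le hQ hR a (b t) hc.pos hl.pos
      have h2 : ∑ p, ∑ q, ((rotDiag Q a - rotDiag (R t) (b t)) p q) ^ 2 = t ^ 2 * K := by
        rw [hb, hK, Finset.mul_sum]
        refine Finset.sum_congr rfl fun p _ => ?_
        rw [Finset.mul_sum]
        refine Finset.sum_congr rfl fun q _ => ?_
        simp only [Matrix.sub_apply, Matrix.add_apply, Matrix.smul_apply, smul_eq_mul]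
        ring
      rw [h2] at h1
      refine le_trans ?_ h1
      refine le_trans ?_ (Finset.single_le_sum (f := fun p => ∑ q, ((rotDiag Q (levelInv a c)
        - rotDiag (R t) (levelInv (b t) (e t))) p q) ^ 2)
        (fun p _ => Finset.sum_nonneg fun q _ => sq_nonneg _) (Finset.mem_univ p))
      exact Finset.single_le_sum (f := fun q => ((rotDiag Q (levelInv a c)
        - rotDiag (R t) (levelInv (b t) (e t))) p q) ^ 2)
        (fun q _ => sq_nonneg _) (Finset.mem_univ q)
    have habs := hsq.sqrt
    simp only [Real.sqrt_sq_eq_abs, Real.sqrt_zero] at habs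
    have := ((tendsto_zero_iff_abs_tendsto_zero _).2 habs).const_sub
      (rotDiag Q (levelInv a c) p q)
    simpa using this
  exact tendsto_pi_nhds.2 fun p => tendsto_pi_nhds.2 fun q => hentry p q

/-- Directional-derivative proposition for `f_DDFact`: for `x, x+d ∈ dom(f_DDFact;Υ)₊`,
the one-sided limit `lim_{t→0⁺} (f_DDFact(x+td;Υ) − f_DDFact(x;Υ))/t` exists and equals
`(Υ ∘ diag(F Q Diag(β) Qᵀ Fᵀ))ᵀ d − (log Υ)ᵀ d`; since the decomposition `(Q,λ)` is
arbitrary here, the value is independent of the choices of `F` and `Q`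
(with `β` adjusted accordingly). -/
theorem stmt_17 (n k s r : ℕ) (hn : 1 < n) (hs0 : 0 < s) (hsn : s < n)
    (C : Matrix (Fin n) (Fin n) ℝ) (hC : C.PosSemidef)
    (hr : C.rank = r) (hrs : s ≤ r)
    (F : Matrix (Fin n) (Fin k) ℝ) (hF : C = F * Fᵀ) (hk1 : r ≤ k) (hk2 : k ≤ n)
    (Υ : Fin n → ℝ) (hΥ : ∀ i, 0 < Υ i)
    (x : Fin n → ℝ) (hx0 : ∀ i, 0 ≤ x i) (hxr : s ≤ (FDD n k F x Υ).rank)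
    (d : Fin n → ℝ) (hd0 : ∀ i, 0 ≤ x i + d i)
    (hdr : s ≤ (FDD n k F (x + d) Υ).rank)
    (Q : Matrix (Fin k) (Fin k) ℝ) (lam : ℕ → ℝ)
    (hdec : IsSpectralDecomp n k F x Υ Q lam) :
    Filter.Tendsto
      (fun t : ℝ => (fDD n k s F (x + t • d) Υ - fDD n k s F x Υ) / t)
      (nhdsWithin 0 (Set.Ioi 0))
      (nhds (∑ i, (Υ i * (gMat n k s F Q lam) i i - Real.log (Υ i)) * d i)) := by
  obtain ⟨hQ, hX, h0, hanti⟩ := hdec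
  have hsk : s ≤ k := hxr.trans (Matrix.rank_le_width _)
  set D := FDD n k F d Υ with hD
  set a : Fin k → ℝ := fun j => lam (j + 1) with ha
  replace hX : FDD n k F x Υ = rotDiag Q a := hX
  have hpos : 0 < lam s := pos_of_le_rank (Q := Q) hs0 h0 hanti (hX ▸ hxr)
  set c := levelOf k s lam with hc_def
  have hc : IsLevel s a c := isLevel_levelOf hs0 hsk h0 hanti hpos
  have hXt : ∀ t : ℝ, FDD n k F (x + t • d) Υ = rotDiag Q a + t • D := fun t => by
    rw [FDD_add_smul, hX]
  have hpsd : ∀ t ∈ Set.Icc (0 : ℝ) 1, (rotDiag Q a + t • D).PosSemidef := fun t ht => by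
    rw [← hXt]
    refine posSemidef_FDD F hΥ fun i => ?_
    have := mul_nonneg ht.1 (hd0 i)
    have := mul_nonneg (sub_nonneg.2 ht.2) (hx0 i)
    simp only [Pi.add_apply, Pi.smul_apply, smul_eq_mul]
    linarith
  have hD1 : (rotDiag Q a + D).PosSemidef := by
    simpa using hpsd 1 ⟨zero_le_one, le_rfl⟩
  set μ : ℝ → ℕ → ℝ := fun t => eigsDesc k (rotDiag Q a + t • D) with hμ
  set b : ℝ → Fin k → ℝ := fun t j => μ t (j + 1) with hb_def
  set e : ℝ → ℝ := fun t => levelOf k s (μ t) with he_def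
  have hR : ∀ t ∈ Set.Ico (0 : ℝ) 1, ∃ R : Matrix (Fin k) (Fin k) ℝ, R * Rᵀ = 1 ∧
      rotDiag R (b t) = rotDiag Q a + t • D ∧ (∀ i, 0 ≤ b t i) ∧ IsLevel s (b t) (e t) ∧
      gammaS k s (rotDiag Q a + t • D) = levelValue (b t) (e t) := by
    intro t ht
    obtain ⟨⟨R, hR, hRX⟩, hμ0, hμanti⟩ := exists_rotDiag_eigsDesc (hpsd t ⟨ht.1, ht.2.le⟩)
    have hu : 0 < (1 - t) * c := mul_pos (sub_pos.2 ht.2) hc.pos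
    have hμs : 0 < μ t s := pos_of_mul_le_sum_min hs0 hsk hμanti hu
      (mul_le_sum_min_of_add_smul hQ hR (fun i => h0 _) hc ht.1 ht.2 hD1 hRX.symm hu.le le_rfl)
    exact ⟨R, hR, hRX.symm, fun i => hμ0 _, isLevel_levelOf hs0 hsk hμ0 hμanti hμs,
      phiS_eq_levelValue hs0 hsk hμ0 hμanti hμs⟩
  choose! R hRorth hRX hb0 hlev hval using hR
  have hval0 : gammaS k s (rotDiag Q a) = levelValue a c := by
    have hz : (0 : ℝ) ∈ Set.Ico (0 : ℝ) 1 := ⟨le_rfl, one_pos⟩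
    have hX0 : rotDiag (R 0) (b 0) = rotDiag Q a := by rw [hRX 0 hz]; simp
    have h1 := levelValue_le hQ (hRorth 0 hz) (hb0 0 hz) hc (hlev 0 hz)
    have h2 := levelValue_le (hRorth 0 hz) hQ (fun i => h0 _) (hlev 0 hz) hc
    have h3 := hval 0 hz
    rw [hX0, sub_self, mul_zero, Matrix.trace_zero, add_zero] at h1 h2
    rw [zero_smul, add_zero] at h3
    rw [h3]
    exact le_antisymm h1 h2
  set T := (rotDiag Q (levelInv a c) * D).trace with hT
  have hquot : Filter.Tendsto
      (fun t : ℝ => (gammaS k s (rotDiag Q a + t • D) - gammaS k s (rotDiag Q a)) / t)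
      (nhdsWithin 0 (Set.Ioi 0)) (nhds T) := by
    have hlim : Filter.Tendsto (fun t => (rotDiag (R t) (levelInv (b t) (e t)) * D).trace)
        (nhdsWithin 0 (Set.Ioi 0)) (nhds T) := by
      have hcont : Continuous fun M : Matrix (Fin k) (Fin k) ℝ => (M * D).trace := by fun_prop
      exact (hcont.tendsto _).comp (tendsto_rotDiag_levelInv hQ (fun i => h0 _) hc hD1
        fun t ht => ⟨hRorth t ⟨ht.1.le, ht.2⟩, hRX t ⟨ht.1.le, ht.2⟩, hb0 t ⟨ht.1.le, ht.2⟩,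
          hlev t ⟨ht.1.le, ht.2⟩⟩)
    refine tendsto_of_tendsto_of_tendsto_of_le_of_le' hlim tendsto_const_nhds ?_ ?_
    · filter_upwards [Ioo_mem_nhdsGT (one_pos (α := ℝ))] with t ht
      have ht' : t ∈ Set.Ico (0 : ℝ) 1 := ⟨ht.1.le, ht.2⟩
      have h1 := levelValue_le (hRorth t ht') hQ (fun i => h0 _) (hlev t ht') hc
      rw [hRX t ht', sub_add_cancel_left, mul_neg, Matrix.trace_neg, Matrix.mul_smul,
        Matrix.trace_smul, smul_eq_mul] at h1
      rw [hval t ht', hval0, le_div_iff₀ ht.1]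
      linarith
    · filter_upwards [Ioo_mem_nhdsGT (one_pos (α := ℝ))] with t ht
      have ht' : t ∈ Set.Ico (0 : ℝ) 1 := ⟨ht.1.le, ht.2⟩
      have h1 := levelValue_le hQ (hRorth t ht') (hb0 t ht') hc (hlev t ht')
      rw [hRX t ht', add_sub_cancel_left, Matrix.mul_smul, Matrix.trace_smul, smul_eq_mul] at h1
      rw [hval t ht', hval0, div_le_iff₀ ht.1]
      linarith
  have hgoal : ∑ i, (Υ i * (gMat n k s F Q lam) i i - Real.log (Υ i)) * d i
      = T - ∑ i, d i * Real.log (Υ i) := by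
    rw [hT, hD, trace_rotDiag_mul_FDD, ← Finset.sum_sub_distrib]
    refine Finset.sum_congr rfl fun i _ => ?_
    rw [gMat, betaOf_eq_levelInv hs0 hsk h0 hanti]
    ring
  rw [hgoal]
  refine (hquot.sub_const _).congr' ?_
  filter_upwards [self_mem_nhdsWithin] with t ht
  have ht0 : t ≠ 0 := (Set.mem_Ioi.1 ht).ne'
  have hlin : ∑ i, (x + t • d) i * Real.log (Υ i)
      = ∑ i, x i * Real.log (Υ i) + t * ∑ i, d i * Real.log (Υ i) := by
    rw [Finset.mul_sum, ← Finset.sum_add_distrib]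
    refine Finset.sum_congr rfl fun i _ => ?_
    simp only [Pi.add_apply, Pi.smul_apply, smul_eq_mul]
    ring
  rw [fDD, fDD, hXt, hX, hlin]
  field_simp
  ring

end
end
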